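/- Let q ≥ 2 be an integer and let δ_q = (q²−1)/(4q) if q is odd and δ_q = q/4 if q is even. Then: (i) for every real δ ≥ δ_q, H⁺_δ = log q; and (ii) for every real δ with 0 < δ < δ_q, H⁺_δ = β(δ)·δ + log Z(β(δ)) = H(φ*_{β(δ)}), where β(δ) > 0 is the unique positive real with mean Lee weight μ(β(δ)) = δ under the Boltzmann distribution φ*_{β(δ)}, and H denotes Shannon entropy in nats. -/

import Mathlib

/-- The Lee weight of an element of `ZMod q`: `min(a, q - a)` for the least
nonnegative residue `a`. -/
def leeWt (q : ℕ) [NeZero q] (a : ZMod q) : ℕ := min a.val (q - a.val)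

/-- The partition function `Z(β) = ∑_{e ∈ Z_q} exp(-β · w_L(e))`. -/
noncomputable def Zfun (q : ℕ) [NeZero q] (β : ℝ) : ℝ :=
  ∑ e : ZMod q, Real.exp (-β * (leeWt q e : ℝ))

/-- The Boltzmann distribution `φ*_β(i) = exp(-β · w_L(i)) / Z(β)` on `Z_q`. -/
noncomputable def boltz (q : ℕ) [NeZero q] (β : ℝ) (i : ZMod q) : ℝ :=
  Real.exp (-β * (leeWt q i : ℝ)) / Zfun q β

/-- The mean Lee weight `μ(β) = ∑_i w_L(i) · φ*_β(i)` under the Boltzmann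
distribution. -/
noncomputable def meanLee (q : ℕ) [NeZero q] (β : ℝ) : ℝ :=
  ∑ i : ZMod q, (leeWt q i : ℝ) * boltz q β i

/-- Shannon entropy (in nats) of a pmf on `Z_q`:
`H(φ) = -∑_{i : φ i ≠ 0} φ i · log (φ i)` (terms with `φ i = 0` contribute `0`). -/
noncomputable def shEntropy (q : ℕ) [NeZero q] (φ : ZMod q → ℝ) : ℝ :=
  ∑ i : ZMod q, Real.negMulLog (φ i)

/-- `δ_q = (q²-1)/(4q)` if `q` is odd, `q/4` if `q` is even. -/
noncomputable def deltaQ (q : ℕ) : ℝ :=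
  if Odd q then ((q : ℝ) ^ 2 - 1) / (4 * q) else (q : ℝ) / 4

/-- `H⁺_δ = inf_{β ≥ 0} (β·δ + log Z(β))`. -/
noncomputable def Hplus (q : ℕ) [NeZero q] (δ : ℝ) : ℝ :=
  ⨅ β : {b : ℝ // 0 ≤ b}, ((β : ℝ) * δ + Real.log (Zfun q (β : ℝ)))

lemma Zfun_pos (q : ℕ) [NeZero q] (β : ℝ) : 0 < Zfun q β :=
  Finset.sum_pos (fun _ _ => Real.exp_pos _) Finset.univ_nonempty

lemma leeWt_zero (q : ℕ) [NeZero q] : leeWt q 0 = 0 := by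
  simp [leeWt]

lemma leeWt_one_pos (q : ℕ) [NeZero q] (hq : 2 ≤ q) : 0 < leeWt q 1 := by
  have : Fact (1 < q) := ⟨hq⟩
  rw [leeWt, ZMod.val_one]
  omega

lemma one_le_Zfun (q : ℕ) [NeZero q] (β : ℝ) : 1 ≤ Zfun q β := by
  have h := Finset.single_le_sum (f := fun e : ZMod q => Real.exp (-β * (leeWt q e : ℝ)))
    (fun _ _ => (Real.exp_pos _).le) (Finset.mem_univ (0 : ZMod q))
  simpa [leeWt_zero, Zfun] using h

lemma Zfun_zero (q : ℕ) [NeZero q] : Zfun q 0 = q := by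
  simp [Zfun, ZMod.card]

lemma boltz_pos (q : ℕ) [NeZero q] (β : ℝ) (i : ZMod q) : 0 < boltz q β i :=
  div_pos (Real.exp_pos _) (Zfun_pos q β)

lemma sum_boltz (q : ℕ) [NeZero q] (β : ℝ) : ∑ i, boltz q β i = 1 := by
  simp only [boltz, ← Finset.sum_div]
  exact div_self (Zfun_pos q β).ne'

lemma Zfun_eq_mul_sum (q : ℕ) [NeZero q] (β γ : ℝ) :
    Zfun q γ = Zfun q β * ∑ i, boltz q β i * Real.exp (-(γ - β) * (leeWt q i : ℝ)) := by
  rw [Finset.mul_sum, Zfun]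
  refine Finset.sum_congr rfl fun i _ => ?_
  have hZ := (Zfun_pos q β).ne'
  rw [boltz, ← mul_assoc, mul_div_cancel₀ _ hZ, ← Real.exp_add]
  congr 1
  ring

/-- The tangent line of `log Z` at `β` has slope `-μ(β)` and lies strictly below the graph
away from `β`. -/
lemma log_Zfun_tangent_lt (q : ℕ) [NeZero q] (hq : 2 ≤ q) {β γ : ℝ} (h : γ ≠ β) :
    Real.log (Zfun q β) - (γ - β) * meanLee q β < Real.log (Zfun q γ) := by
  set m := meanLee q β with hm
  have hsum : ∑ i, boltz q β i * (-(γ - β) * ((leeWt q i : ℝ) - m) + 1) = 1 := by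
    have : ∀ i, boltz q β i * (-(γ - β) * ((leeWt q i : ℝ) - m) + 1)
        = -(γ - β) * ((leeWt q i : ℝ) * boltz q β i) + ((γ - β) * m + 1) * boltz q β i := by
      intro i; ring
    simp only [this, Finset.sum_add_distrib, ← Finset.mul_sum, sum_boltz]
    rw [← meanLee, ← hm]
    ring
  have hlt : 1 < ∑ i, boltz q β i * Real.exp (-(γ - β) * ((leeWt q i : ℝ) - m)) := by
    rw [← hsum]
    refine Finset.sum_lt_sum
      (fun i _ => mul_le_mul_of_nonneg_left (Real.add_one_le_exp _) (boltz_pos q β i).le) ?_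
    obtain ⟨i, hi⟩ : ∃ i : ZMod q, (leeWt q i : ℝ) ≠ m := by
      by_contra! hall
      have h1 : (leeWt q 1 : ℝ) = leeWt q 0 := (hall 1).trans (hall 0).symm
      rw [leeWt_zero] at h1
      exact (leeWt_one_pos q hq).ne' (by exact_mod_cast h1)
    refine ⟨i, Finset.mem_univ _, mul_lt_mul_of_pos_left (Real.add_one_lt_exp ?_) (boltz_pos q β i)⟩
    exact mul_ne_zero (neg_ne_zero.2 (sub_ne_zero.2 h)) (sub_ne_zero.2 hi)
  have hfac : ∑ i, boltz q β i * Real.exp (-(γ - β) * (leeWt q i : ℝ))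
      = Real.exp (-(γ - β) * m) *
        ∑ i, boltz q β i * Real.exp (-(γ - β) * ((leeWt q i : ℝ) - m)) := by
    rw [Finset.mul_sum]
    refine Finset.sum_congr rfl fun i _ => ?_
    rw [mul_left_comm, ← Real.exp_add]
    congr 2
    ring
  rw [Zfun_eq_mul_sum q β γ, hfac, Real.log_mul (Zfun_pos q β).ne' (by positivity),
    Real.log_mul (Real.exp_pos _).ne' (by positivity), Real.log_exp]
  have := Real.log_pos hlt
  linarith

lemma log_Zfun_tangent_le (q : ℕ) [NeZero q] (hq : 2 ≤ q) (β γ : ℝ) :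
    Real.log (Zfun q β) - (γ - β) * meanLee q β ≤ Real.log (Zfun q γ) := by
  rcases eq_or_ne γ β with rfl | h
  · simp
  · exact (log_Zfun_tangent_lt q hq h).le

lemma meanLee_injective (q : ℕ) [NeZero q] (hq : 2 ≤ q) : Function.Injective (meanLee q) := by
  intro β γ h
  by_contra hne
  have h1 := log_Zfun_tangent_lt q hq (Ne.symm hne)
  have h2 := log_Zfun_tangent_lt q hq hne
  rw [h] at h1
  linarith

/-- `H⁺_δ` is attained at any `β ≥ 0` minimizing `γ·δ + log Z(γ)` over `γ ≥ 0`. -/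
lemma Hplus_eq_of_forall_le (q : ℕ) [NeZero q] {δ β : ℝ} (hβ : 0 ≤ β)
    (h : ∀ γ : ℝ, 0 ≤ γ → β * δ + Real.log (Zfun q β) ≤ γ * δ + Real.log (Zfun q γ)) :
    Hplus q δ = β * δ + Real.log (Zfun q β) := by
  have : Nonempty {b : ℝ // 0 ≤ b} := ⟨⟨0, le_rfl⟩⟩
  refine le_antisymm ?_ (le_ciInf fun γ => h γ γ.2)
  exact ciInf_le (f := fun γ : {b : ℝ // 0 ≤ b} => (γ : ℝ) * δ + Real.log (Zfun q (γ : ℝ)))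
    ⟨_, Set.forall_mem_range.2 fun γ => h γ γ.2⟩ ⟨β, hβ⟩

lemma sum_leeWt_eq_sum_range (q : ℕ) [NeZero q] :
    ∑ i : ZMod q, leeWt q i = ∑ i ∈ Finset.range q, min i (q - i) := by
  obtain ⟨n, rfl⟩ := Nat.exists_eq_succ_of_ne_zero (NeZero.ne q)
  exact Fin.sum_univ_eq_sum_range (fun i => min i (n + 1 - i)) (n + 1)

lemma sum_range_min_even (m : ℕ) :
    ∑ i ∈ Finset.range (m + m), min i (m + m - i) = m * m := by
  rw [Finset.sum_range_add, ← Finset.sum_add_distrib]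
  trans ∑ i ∈ Finset.range m, m
  · refine Finset.sum_congr rfl fun i hi => ?_
    rw [Finset.mem_range] at hi
    omega
  · simp

lemma sum_range_min_odd (m : ℕ) :
    ∑ i ∈ Finset.range (m + 1 + m), min i (m + 1 + m - i) = m * m + m := by
  rw [Finset.sum_range_add, Finset.sum_range_succ, add_right_comm, ← Finset.sum_add_distrib]
  congr 1
  · trans ∑ i ∈ Finset.range m, m
    · refine Finset.sum_congr rfl fun i hi => ?_
      rw [Finset.mem_range] at hi
      omega
    · simp
  · omega

lemma meanLee_zero (q : ℕ) [NeZero q] : meanLee q 0 = deltaQ q := by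
  have hq : (q : ℝ) ≠ 0 := Nat.cast_ne_zero.2 (NeZero.ne q)
  have h : meanLee q 0 = ((∑ i ∈ Finset.range q, min i (q - i) : ℕ) : ℝ) / q := by
    rw [← sum_leeWt_eq_sum_range, Nat.cast_sum, Finset.sum_div]
    simp [meanLee, boltz, Zfun_zero, div_eq_mul_inv]
  rw [h, deltaQ]
  split_ifs with ho
  · obtain ⟨m, hm⟩ := ho
    rw [show q = m + 1 + m by omega] at hq ⊢
    rw [sum_range_min_odd]
    field_simp
    push_cast
    ring
  · obtain ⟨m, hm⟩ := Nat.not_odd_iff_even.1 ho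
    rw [hm] at hq ⊢
    rw [sum_range_min_even]
    field_simp
    push_cast
    ring

lemma continuous_meanLee (q : ℕ) [NeZero q] : Continuous (meanLee q) := by
  have hZ : Continuous (Zfun q) := by
    unfold Zfun
    fun_prop
  unfold meanLee boltz
  exact continuous_finsetSum _ fun i _ => continuous_const.mul
    (Continuous.div (by fun_prop) hZ fun β => (Zfun_pos q β).ne')

lemma meanLee_le_div (q : ℕ) [NeZero q] {β : ℝ} (hβ : 0 < β) : meanLee q β ≤ q / β := by
  have hterm : ∀ i : ZMod q, (leeWt q i : ℝ) * boltz q β i ≤ 1 / β := by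
    intro i
    have h1 : boltz q β i ≤ Real.exp (-β * (leeWt q i : ℝ)) :=
      div_le_self (Real.exp_pos _).le (one_le_Zfun q β)
    refine (mul_le_mul_of_nonneg_left h1 (Nat.cast_nonneg _)).trans ?_
    rw [neg_mul, Real.exp_neg, ← div_eq_mul_inv, div_le_div_iff₀ (Real.exp_pos _) hβ]
    linarith [Real.add_one_le_exp (β * (leeWt q i : ℝ))]
  calc meanLee q β ≤ ∑ _i : ZMod q, 1 / β := Finset.sum_le_sum fun i _ => hterm i
    _ = q / β := by simp [ZMod.card, div_eq_mul_inv]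

lemma exists_meanLee_eq (q : ℕ) [NeZero q] {δ : ℝ} (h0 : 0 < δ) (h1 : δ < deltaQ q) :
    ∃ β : ℝ, 0 < β ∧ meanLee q β = δ := by
  have hq : (0 : ℝ) < q := Nat.cast_pos.2 (NeZero.pos q)
  have hb : 0 < q / δ := div_pos hq h0
  have hle : meanLee q (q / δ) ≤ δ := by
    simpa [div_div_cancel₀ hq.ne'] using meanLee_le_div q hb
  obtain ⟨β, hβ, hm⟩ := intermediate_value_Icc' hb.le (continuous_meanLee q).continuousOn
    ⟨hle, (meanLee_zero q).symm ▸ h1.le⟩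
  refine ⟨β, lt_of_le_of_ne hβ.1 ?_, hm⟩
  rintro rfl
  rw [meanLee_zero] at hm
  exact h1.ne' hm

lemma shEntropy_boltz (q : ℕ) [NeZero q] (β : ℝ) :
    shEntropy q (boltz q β) = β * meanLee q β + Real.log (Zfun q β) := by
  have : ∀ i, Real.negMulLog (boltz q β i)
      = β * ((leeWt q i : ℝ) * boltz q β i) + Real.log (Zfun q β) * boltz q β i := by
    intro i
    have hlog : Real.log (boltz q β i) = -β * (leeWt q i : ℝ) - Real.log (Zfun q β) := by
      rw [boltz, Real.log_div (Real.exp_pos _).ne' (Zfun_pos q β).ne', Real.log_exp]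
    rw [Real.negMulLog, hlog]
    ring
  simp only [shEntropy, this, Finset.sum_add_distrib, ← Finset.mul_sum, sum_boltz, mul_one, meanLee]

/-- (i) For `δ ≥ δ_q`, `H⁺_δ = log q`; (ii) for `0 < δ < δ_q` there is a unique
`β > 0` with `μ(β) = δ`, and for this `β` one has
`H⁺_δ = β·δ + log Z(β) = H(φ*_β)`. -/
theorem Hplus_eval (q : ℕ) [NeZero q] (hq : 2 ≤ q) :
    (∀ δ : ℝ, deltaQ q ≤ δ → Hplus q δ = Real.log q) ∧
    (∀ δ : ℝ, 0 < δ → δ < deltaQ q →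
      (∃! β : ℝ, 0 < β ∧ meanLee q β = δ) ∧
      ∀ β : ℝ, 0 < β → meanLee q β = δ →
        Hplus q δ = β * δ + Real.log (Zfun q β) ∧
        β * δ + Real.log (Zfun q β) = shEntropy q (boltz q β)) := by
  refine ⟨fun δ hδ => ?_, fun δ h0 h1 => ⟨?_, fun β hβ hm => ⟨?_, ?_⟩⟩⟩
  · rw [Hplus_eq_of_forall_le q le_rfl fun γ hγ => ?_, Zfun_zero, zero_mul, zero_add]
    have ht := log_Zfun_tangent_le q hq 0 γ
    rw [meanLee_zero] at ht
    linarith [mul_le_mul_of_nonneg_left hδ hγ]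
  · obtain ⟨β, hβ, hm⟩ := exists_meanLee_eq q h0 h1
    exact ⟨β, ⟨hβ, hm⟩, fun γ hγ => meanLee_injective q hq (hγ.2.trans hm.symm)⟩
  · refine Hplus_eq_of_forall_le q hβ.le fun γ _ => ?_
    have ht := log_Zfun_tangent_le q hq β γ
    rw [hm] at ht
    linarith
  · rw [shEntropy_boltz, hm]
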